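/- arXiv:1305.1831 — 2 statements merged into one kernel-verified Lean document; each statement's English description precedes it below -/
import Mathlib

section
/- Under the carry-sequence setup, let t be an integer with 1 ≤ t ≤ m. If for some index i we have c_i = c_{i−t} = 5 and c_{i−1} ≤ 4, c_{i−2} ≤ 4, …, c_{i−(t−1)} ≤ 4, then there exists an integer ℓ with 1 ≤ ℓ ≤ t−1 such that c_{i−ℓ} < 4. -/
/-- A carry is never `6`. -/
theorem carry_le_five (a b c : ℤ → ℤ)
    (ha : ∀ i, 0 ≤ a i ∧ a i ≤ 2) (hb : ∀ i, 0 ≤ b i ∧ b i ≤ 2) (hc : ∀ i, 0 ≤ c i ∧ c i ≤ 6)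
    (hs : ∀ i, 0 ≤ (9 - 2 * a (i - 1) + a i - b (i - 2) + b (i - 1) - b i) - 3 * c i + c (i - 1) ∧
      (9 - 2 * a (i - 1) + a i - b (i - 2) + b (i - 1) - b i) - 3 * c i + c (i - 1) ≤ 2)
    (i : ℤ) : c i ≤ 5 := by
  have h₀ := hs i
  have h₁ := hs (i - 1)
  rw [show i - 1 - 1 = i - 2 by ring, show i - 1 - 2 = i - 3 by ring] at h₁
  have := ha i; have := ha (i - 1); have := ha (i - 2)
  have := hb i; have := hb (i - 1); have := hb (i - 2); have := hb (i - 3)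
  have := hc i; have := hc (i - 1); have := hc (i - 2)
  omega

/-- The constraint on the digits at a position with carry `5`. -/
theorem digits_of_carry_eq_five (a b c : ℤ → ℤ)
    (ha : ∀ i, 0 ≤ a i ∧ a i ≤ 2) (hb : ∀ i, 0 ≤ b i ∧ b i ≤ 2) (hc : ∀ i, c i ≤ 5)
    (hs : ∀ i, 0 ≤ (9 - 2 * a (i - 1) + a i - b (i - 2) + b (i - 1) - b i) - 3 * c i + c (i - 1) ∧
      (9 - 2 * a (i - 1) + a i - b (i - 2) + b (i - 1) - b i) - 3 * c i + c (i - 1) ≤ 2)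
    (i : ℤ) (h : c i = 5) : 2 * b i - b (i - 1) + 3 ≤ 2 * a i := by
  have h₀ := hs i
  have h₁ := hs (i - 1)
  have h₂ := hs (i - 2)
  rw [show i - 1 - 1 = i - 2 by ring, show i - 1 - 2 = i - 3 by ring] at h₁
  rw [show i - 2 - 1 = i - 3 by ring, show i - 2 - 2 = i - 4 by ring] at h₂
  have := ha i; have := ha (i - 1); have := ha (i - 2); have := ha (i - 3)
  have := hb i; have := hb (i - 1); have := hb (i - 2); have := hb (i - 3); have := hb (i - 4)
  have := hc (i - 1); have := hc (i - 2); have := hc (i - 3)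
  omega

/-- After a carry `5` followed only by carries `4`, the next carry is not `5`. -/
theorem carry_ne_five_of_five_of_forall_four (a b c : ℤ → ℤ)
    (ha : ∀ i, 0 ≤ a i ∧ a i ≤ 2) (hb : ∀ i, 0 ≤ b i ∧ b i ≤ 2) (hc : ∀ i, 0 ≤ c i ∧ c i ≤ 6)
    (hs : ∀ i, 0 ≤ (9 - 2 * a (i - 1) + a i - b (i - 2) + b (i - 1) - b i) - 3 * c i + c (i - 1) ∧
      (9 - 2 * a (i - 1) + a i - b (i - 2) + b (i - 1) - b i) - 3 * c i + c (i - 1) ≤ 2)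
    (k : ℤ) (h5 : c k = 5) (n : ℕ) (h4 : ∀ j : ℤ, 1 ≤ j → j ≤ n → c (k + j) = 4) :
    c (k + n + 1) ≠ 5 := by
  have hQ := digits_of_carry_eq_five a b c ha hb (carry_le_five a b c ha hb hc hs) hs k h5
  have step (x : ℤ) := hs (x + 1)
  simp only [add_sub_cancel_right, show ∀ x : ℤ, x + 1 - 2 = x - 1 by intro x; ring] at step
  rcases n with _ | n
  · have := step k
    have := ha (k + 1)
    have := hb (k + 1); have := hb k; have := hb (k - 1)
    simp only [Nat.cast_zero, add_zero]
    omega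
  have key : ∀ r : ℕ, r ≤ n → 1 + b (k + r + 1) + b (k + r) ≤ a (k + r + 1) := by
    intro r
    induction r with
    | zero =>
      intro _
      have := step k
      have := h4 1 le_rfl (by omega)
      have := hb k
      simp only [Nat.cast_zero, add_zero]
      omega
    | succ r ih =>
      intro hr
      have ih := ih (by omega)
      have h := step (k + r + 1)
      have h₁ := h4 (r + 1) (by omega) (by omega)
      have h₂ := h4 (r + 2) (by omega) (by omega)
      have := hb (k + r)
      rw [show k + ((r : ℤ) + 1) = k + r + 1 by ring] at h₁
      rw [show k + ((r : ℤ) + 2) = k + r + 1 + 1 by ring] at h₂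
      rw [show k + (r : ℤ) + 1 - 1 = k + r by ring] at h
      push_cast
      rw [show k + ((r : ℤ) + 1) = k + r + 1 by ring]
      omega
  have hP := key n le_rfl
  have h := step (k + n + 1)
  have h₁ := h4 (n + 1) (by omega) (by omega)
  rw [show k + ((n : ℤ) + 1) = k + n + 1 by ring] at h₁
  rw [show k + (n : ℤ) + 1 - 1 = k + n by ring] at h
  have := ha (k + n + 1 + 1)
  have := hb (k + n); have := hb (k + n + 1); have := hb (k + n + 1 + 1)
  push_cast
  rw [show k + ((n : ℤ) + 1) = k + n + 1 by ring]
  omega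


/-- In the carry-sequence setup, if `c_i = c_{i−t} = 5` for some `1 ≤ t ≤ m` and all
intermediate carries are at most `4`, then some intermediate carry is strictly less
than `4`. -/
theorem carry_between_two_fives_some_lt_four
    (m : ℕ) (hm : 0 < m)
    (a b c : ℤ → ℤ)
    (ha : ∀ i, 0 ≤ a i ∧ a i ≤ 2) (hap : ∀ i, a (i + (m : ℤ)) = a i)
    (hb : ∀ i, 0 ≤ b i ∧ b i ≤ 2) (hbp : ∀ i, b (i + (m : ℤ)) = b i)
    (hc : ∀ i, 0 ≤ c i ∧ c i ≤ 6) (hcp : ∀ i, c (i + (m : ℤ)) = c i)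
    (hs : ∀ i, 0 ≤ (9 - 2 * a (i - 1) + a i - b (i - 2) + b (i - 1) - b i) - 3 * c i + c (i - 1) ∧
      (9 - 2 * a (i - 1) + a i - b (i - 2) + b (i - 1) - b i) - 3 * c i + c (i - 1) ≤ 2) :
    ∀ i, ∀ t : ℤ, 1 ≤ t → t ≤ (m : ℤ) → c i = 5 → c (i - t) = 5 →
      (∀ j : ℤ, 1 ≤ j → j ≤ t - 1 → c (i - j) ≤ 4) →
      ∃ l : ℤ, 1 ≤ l ∧ l ≤ t - 1 ∧ c (i - l) < 4 := by
  intro i t ht _ hi hit hle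
  by_contra! hge
  obtain ⟨n, hn⟩ := Int.eq_ofNat_of_zero_le (show 0 ≤ t - 1 by omega)
  refine carry_ne_five_of_five_of_forall_four a b c ha hb hc hs (i - t) hit n (fun j hj hjn => ?_) ?_
  · rw [show i - t + j = i - (t - j) by ring]
    exact le_antisymm (hle _ (by omega) (by omega)) (hge _ (by omega) (by omega))
  · rwa [show i - t + n + 1 = i by omega]
end

section
/- Under the carry-sequence setup, Σ_{i=0}^{m−1} c_i ≤ 4m. -/
/-- A potential on the states of the carry recursion. Here `f` collects the contribution of the past
to the next carry, and `y` is the latest digit of `b`; the value is the largest possible excess over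
`4` per step of the future carries. -/
def carryPotential (f y : ℤ) : ℤ :=
  if y = 0 then if f ≤ 2 then 0 else if f ≤ 4 then 1 else if f ≤ 5 then 2 else 3
  else if y = 1 then if f ≤ 2 then 0 else if f ≤ 5 then 1 else 2
  else if f ≤ 3 then 0 else if f ≤ 5 then 1 else 2

theorem add_carryPotential_le {f x y z k : ℤ} (hf : f ≤ 6 + y) (hx : 0 ≤ x ∧ x ≤ 2)
    (hy : 0 ≤ y ∧ y ≤ 2) (hz : 0 ≤ z ∧ z ≤ 2) (hk : 3 * k ≤ 9 + f + x - z) :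
    k + carryPotential (-2 * x - y + z + k) z ≤ 4 + carryPotential f y := by
  obtain ⟨hx₀, hx₂⟩ := hx
  obtain ⟨hy₀, hy₂⟩ := hy
  obtain ⟨hz₀, hz₂⟩ := hz
  unfold carryPotential
  interval_cases y <;> interval_cases z <;> norm_num <;> split_ifs <;> omega

/-- In the carry-sequence setup, the total carry over one period is at most `4m`:
`Σ_{i=0}^{m−1} c_i ≤ 4m`. -/
theorem carry_period_sum_le_four_mul
    (m : ℕ) (hm : 0 < m)
    (a b c : ℤ → ℤ)
    (ha : ∀ i, 0 ≤ a i ∧ a i ≤ 2) (hap : ∀ i, a (i + (m : ℤ)) = a i)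
    (hb : ∀ i, 0 ≤ b i ∧ b i ≤ 2) (hbp : ∀ i, b (i + (m : ℤ)) = b i)
    (hc : ∀ i, 0 ≤ c i ∧ c i ≤ 6) (hcp : ∀ i, c (i + (m : ℤ)) = c i)
    (hs : ∀ i, 0 ≤ (9 - 2 * a (i - 1) + a i - b (i - 2) + b (i - 1) - b i) - 3 * c i + c (i - 1) ∧
      (9 - 2 * a (i - 1) + a i - b (i - 2) + b (i - 1) - b i) - 3 * c i + c (i - 1) ≤ 2) :
    ∑ i ∈ Finset.range m, c (i : ℤ) ≤ 4 * (m : ℤ) := by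
  set P : ℤ → ℤ := fun i ↦
    carryPotential (-2 * a (i - 1) - b (i - 2) + b (i - 1) + c (i - 1)) (b (i - 1)) with hP
  have step (i : ℤ) : c i + P (i + 1) ≤ 4 + P i := by
    have hi : i + 1 - 2 = i - 1 := by ring
    simp only [hP, add_sub_cancel_right, hi]
    have h₁ := ha (i - 1)
    have h₂ := hb (i - 2)
    have h₃ := hc (i - 1)
    have h₄ := hs i
    exact add_carryPotential_le (by omega) (ha i) (hb (i - 1)) (hb i) (by omega)
  have telescope (n : ℕ) : ∑ i ∈ Finset.range n, c (i : ℤ) + P n ≤ 4 * (n : ℤ) + P 0 := by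
    induction n with
    | zero => simp
    | succ n ih =>
      rw [Finset.sum_range_succ]
      have := step n
      push_cast
      linarith
  have periodic : P m = P 0 := by
    have shift (k : ℤ) : (m : ℤ) - k = 0 - k + m := by ring
    simp only [hP, shift, hap, hbp, hcp]
  linarith [telescope m]
end
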